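/- arXiv:2310.12364 — 3 statements merged into one kernel-verified Lean document; each statement's English description precedes it below -/
import Mathlib

section
/- Let M be a real n×n matrix and let v : Ω → ℝ^n be a random vector whose coordinates are independent standard real Gaussian random variables. Then the variance of the scalar random variable vᵀ M v satisfies V[vᵀ M v] = (1/2)‖M + Mᵀ‖_F², and consequently V[vᵀ M v] ≤ 2‖M‖_F². -/
open MeasureTheory ProbabilityTheory Matrix

lemma hasDerivAt_mul_exp_half_sq {p : ℝ → ℝ} {p' t : ℝ} (hp : HasDerivAt p p' t) :
    HasDerivAt (fun t => p t * Real.exp (t ^ 2 / 2)) ((p' + t * p t) * Real.exp (t ^ 2 / 2)) t := by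
  have h : HasDerivAt (fun t : ℝ => Real.exp (t ^ 2 / 2)) (Real.exp (t ^ 2 / 2) * t) t := by
    convert ((hasDerivAt_pow 2 t).div_const 2).exp using 1
    norm_num
  exact (hp.fun_mul h).congr_deriv (by ring)

lemma integral_pow_eq_iteratedDeriv_exp (k : ℕ) :
    ∫ x, x ^ k ∂(gaussianReal 0 1) = iteratedDeriv k (fun t : ℝ => Real.exp (t ^ 2 / 2)) 0 := by
  have h := iteratedDeriv_mgf_zero (X := id) (μ := gaussianReal 0 1) (by simp) k
  rw [mgf_id_gaussianReal] at h
  simpa using h.symm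

lemma gaussianReal_moments :
    (∫ x, x ^ 2 ∂(gaussianReal 0 1) = 1) ∧
    (∫ x, x ^ 3 ∂(gaussianReal 0 1) = 0) ∧ (∫ x, x ^ 4 ∂(gaussianReal 0 1) = 3) := by
  have h1 : deriv (fun t : ℝ => Real.exp (t ^ 2 / 2)) = fun t => t * Real.exp (t ^ 2 / 2) := by
    funext t
    simpa using (hasDerivAt_mul_exp_half_sq (hasDerivAt_const t (1 : ℝ))).deriv
  have h2 : deriv (fun t : ℝ => t * Real.exp (t ^ 2 / 2)) =
      fun t => (1 + t ^ 2) * Real.exp (t ^ 2 / 2) := by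
    funext t
    rw [(hasDerivAt_mul_exp_half_sq (hasDerivAt_id' t)).deriv]
    ring
  have h3 : deriv (fun t : ℝ => (1 + t ^ 2) * Real.exp (t ^ 2 / 2)) =
      fun t => (3 * t + t ^ 3) * Real.exp (t ^ 2 / 2) := by
    funext t
    rw [(hasDerivAt_mul_exp_half_sq ((hasDerivAt_pow 2 t).const_add 1)).deriv]
    norm_num
    ring
  have h4 : deriv (fun t : ℝ => (3 * t + t ^ 3) * Real.exp (t ^ 2 / 2)) =
      fun t => (3 + 6 * t ^ 2 + t ^ 4) * Real.exp (t ^ 2 / 2) := by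
    funext t
    rw [(hasDerivAt_mul_exp_half_sq
      (((hasDerivAt_id' t).const_mul 3).fun_add (hasDerivAt_pow 3 t))).deriv]
    norm_num
    ring
  simp only [integral_pow_eq_iteratedDeriv_exp, iteratedDeriv_succ', iteratedDeriv_zero,
    h1, h2, h3, h4]
  norm_num

section StandardGaussianVector

variable {ι : Type*} [Fintype ι]

lemma integrable_pi_gaussianReal_monomial (a : ι → ℕ) :
    Integrable (fun x : ι → ℝ => ∏ m, x m ^ a m)
      (Measure.pi fun _ : ι => gaussianReal 0 1) := by
  refine Integrable.fintype_prod (f := fun m (y : ℝ) => y ^ a m) fun m => ?_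
  exact integrable_pow_of_mem_interior_integrableExpSet (X := id) (by simp) (a m)

variable [DecidableEq ι]

lemma prod_pow_ite_eq_mul_mul_mul (x : ι → ℝ) (i j k l : ι) :
    ∏ m, x m ^ ((if m = i then 1 else 0) + (if m = j then 1 else 0) +
      (if m = k then 1 else 0) + (if m = l then 1 else 0)) = (x i * x j) * (x k * x l) := by
  simp only [pow_add, Finset.prod_mul_distrib, pow_ite, pow_one, pow_zero, Finset.prod_ite_eq',
    Finset.mem_univ, if_true, mul_assoc]

lemma integral_pi_gaussianReal_mul (i j : ι) :
    ∫ x, x i * x j ∂(Measure.pi fun _ : ι => gaussianReal 0 1) = if i = j then 1 else 0 := by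
  obtain ⟨m2, -⟩ := gaussianReal_moments
  have h (x : ι → ℝ) : x i * x j =
      ∏ m, x m ^ ((if m = i then 1 else 0) + (if m = j then 1 else 0)) := by
    simp only [pow_add, Finset.prod_mul_distrib, pow_ite, pow_one, pow_zero, Finset.prod_ite_eq',
      Finset.mem_univ, if_true]
  simp_rw [h]
  rw [integral_fintype_prod_eq_prod
    (fun m (y : ℝ) => y ^ ((if m = i then 1 else 0) + (if m = j then 1 else 0)))]
  split_ifs with hij
  · subst hij
    refine Finset.prod_eq_one fun m _ => ?_
    by_cases hm : m = i <;> simp [hm, m2]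
  · refine Finset.prod_eq_zero (Finset.mem_univ i) ?_
    simp [hij]

/-- Isserlis' formula for the fourth moments of a standard Gaussian vector. -/
lemma integral_pi_gaussianReal_mul_mul_mul (i j k l : ι) :
    ∫ x, (x i * x j) * (x k * x l) ∂(Measure.pi fun _ : ι => gaussianReal 0 1) =
      (if i = j then 1 else 0) * (if k = l then 1 else 0) +
      (if i = k then 1 else 0) * (if j = l then 1 else 0) +
      (if i = l then 1 else 0) * (if j = k then 1 else 0) := by
  obtain ⟨m2, m3, m4⟩ := gaussianReal_moments
  simp_rw [← prod_pow_ite_eq_mul_mul_mul]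
  rw [integral_fintype_prod_eq_prod (fun m (y : ℝ) => y ^ ((if m = i then 1 else 0) +
    (if m = j then 1 else 0) + (if m = k then 1 else 0) + (if m = l then 1 else 0)))]
  by_cases hij : i = j
  · subst hij
    by_cases hkl : k = l
    · subst hkl
      by_cases hik : i = k
      · subst hik
        rw [Finset.prod_eq_single i (fun m _ hm => by simp [hm]) (by simp)]
        simp [m4]
        norm_num
      · rw [Finset.prod_eq_one fun m _ => ?_]
        · simp [hik]
        · by_cases hm : m = i
          · subst hm
            simp [hik, m2]
          · by_cases hm' : m = k <;> simp [hm, hm', m2, Ne.symm hik]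
    · rw [Finset.prod_eq_zero (Finset.mem_univ k)]
      · simp only [hkl]
        grind
      · by_cases hki : k = i
        · subst hki
          simp [hkl, m3]
        · simp [hkl, hki]
  · by_cases hik : i = k
    · subst hik
      by_cases hjl : j = l
      · subst hjl
        rw [Finset.prod_eq_one fun m _ => ?_]
        · simp [hij]
        · by_cases hm : m = i
          · subst hm
            simp [hij, m2]
          · by_cases hm' : m = j <;> simp [hm, hm', m2, Ne.symm hij]
      · rw [Finset.prod_eq_zero (Finset.mem_univ j)]
        · simp [hij, hjl, Ne.symm hij]
        · simp [hjl, Ne.symm hij]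
    · by_cases hil : i = l
      · subst hil
        by_cases hjk : j = k
        · subst hjk
          rw [Finset.prod_eq_one fun m _ => ?_]
          · simp [hij]
          · by_cases hm : m = i
            · subst hm
              simp [hij, m2]
            · by_cases hm' : m = j <;> simp [hm, hm', m2, Ne.symm hij]
        · rw [Finset.prod_eq_zero (Finset.mem_univ j)]
          · simp [hij, hjk, hik]
          · simp [hjk, Ne.symm hij]
      · rw [Finset.prod_eq_zero (Finset.mem_univ i)]
        · simp [hij, hik, hil]
        · simp [hij, hik, hil]

lemma memLp_two_pi_gaussianReal_mul (i j : ι) :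
    MemLp (fun x : ι → ℝ => x i * x j) 2 (Measure.pi fun _ : ι => gaussianReal 0 1) := by
  rw [memLp_two_iff_integrable_sq (by fun_prop)]
  simp_rw [pow_two, ← prod_pow_ite_eq_mul_mul_mul]
  exact integrable_pi_gaussianReal_monomial _

lemma covariance_pi_gaussianReal_mul_mul (i j k l : ι) :
    cov[fun x => x i * x j, fun x => x k * x l; Measure.pi fun _ : ι => gaussianReal 0 1] =
      (if i = k then 1 else 0) * (if j = l then 1 else 0) +
      (if i = l then 1 else 0) * (if j = k then 1 else 0) := by
  rw [covariance_eq_sub (memLp_two_pi_gaussianReal_mul i j) (memLp_two_pi_gaussianReal_mul k l)]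
  simp only [Pi.mul_apply, integral_pi_gaussianReal_mul_mul_mul, integral_pi_gaussianReal_mul]
  ring

lemma variance_pi_gaussianReal_quadratic_form (M : Matrix ι ι ℝ) :
    Var[fun x => ∑ i, ∑ j, x i * M i j * x j; Measure.pi fun _ : ι => gaussianReal 0 1] =
      ∑ i, ∑ j, (M i j ^ 2 + M i j * M j i) := by
  have h : (fun x : ι → ℝ => ∑ i, ∑ j, x i * M i j * x j) =
      fun x => ∑ p : ι × ι, M p.1 p.2 * (x p.1 * x p.2) := by
    funext x
    rw [Fintype.sum_prod_type]
    exact Finset.sum_congr rfl fun i _ => Finset.sum_congr rfl fun j _ => by ring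
  rw [h, variance_fun_sum (X := fun (p : ι × ι) (x : ι → ℝ) => M p.1 p.2 * (x p.1 * x p.2))
    fun p => (memLp_two_pi_gaussianReal_mul p.1 p.2).const_mul _]
  simp only [covariance_const_mul_left, covariance_const_mul_right,
    covariance_pi_gaussianReal_mul_mul, Fintype.sum_prod_type]
  simp [mul_add, Finset.sum_add_distrib, pow_two, Finset.sum_ite_irrel, mul_comm]

end StandardGaussianVector

/-- If `v` is a random vector whose coordinates are independent standard real Gaussian
random variables, then `V[vᵀ M v] = (1/2) ‖M + Mᵀ‖_F²`, and consequently
`V[vᵀ M v] ≤ 2 ‖M‖_F²`. -/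
theorem variance_quadratic_form_gaussian
    {n : ℕ} (M : Matrix (Fin n) (Fin n) ℝ)
    {Ω : Type*} [MeasurableSpace Ω] (μ : Measure Ω) [IsProbabilityMeasure μ]
    (v : Ω → Fin n → ℝ) (hv : Measurable v)
    (hdist : Measure.map v μ = Measure.pi (fun _ : Fin n => gaussianReal 0 1)) :
    (∫ ω, ((∑ i, ∑ j, v ω i * M i j * v ω j)
        - ∫ ω', ∑ i, ∑ j, v ω' i * M i j * v ω' j ∂μ) ^ 2 ∂μ
      = (1 / 2 : ℝ) * ∑ i, ∑ j, ((M + Mᵀ) i j) ^ 2)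
    ∧ (∫ ω, ((∑ i, ∑ j, v ω i * M i j * v ω j)
        - ∫ ω', ∑ i, ∑ j, v ω' i * M i j * v ω' j ∂μ) ^ 2 ∂μ
      ≤ 2 * ∑ i, ∑ j, (M i j) ^ 2) := by
  have hvar : ∫ ω, ((∑ i, ∑ j, v ω i * M i j * v ω j)
        - ∫ ω', ∑ i, ∑ j, v ω' i * M i j * v ω' j ∂μ) ^ 2 ∂μ =
      ∑ i, ∑ j, (M i j ^ 2 + M i j * M j i) := by
    rw [← variance_pi_gaussianReal_quadratic_form, ← hdist,
      variance_map (Measurable.aemeasurable (by fun_prop)) hv.aemeasurable,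
      variance_eq_integral (Measurable.aemeasurable (by fun_prop))]
    rfl
  have hswap : ∑ i, ∑ j, M j i ^ 2 = ∑ i, ∑ j, M i j ^ 2 := Finset.sum_comm
  have hmain : ∑ i, ∑ j, (M i j ^ 2 + M i j * M j i) =
      (1 / 2 : ℝ) * ∑ i, ∑ j, ((M + Mᵀ) i j) ^ 2 := by
    simp only [Matrix.add_apply, transpose_apply, add_sq, Finset.sum_add_distrib, hswap, mul_assoc,
      ← Finset.mul_sum]
    ring
  have hle : ∑ i, ∑ j, ((M + Mᵀ) i j) ^ 2 ≤
      ∑ i, ∑ j, (2 * M i j ^ 2 + 2 * M j i ^ 2) := by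
    gcongr with i _ j _
    simp only [Matrix.add_apply, transpose_apply]
    nlinarith [sq_nonneg (M i j - M j i)]
  simp only [Finset.sum_add_distrib, ← Finset.mul_sum, hswap] at hle
  rw [hvar, hmain]
  exact ⟨rfl, by linarith⟩
end

section
/- Let H be a real symmetric d×d matrix, let Q be a real d×k matrix with orthonormal columns satisfying H Q = Q Λ for a k×k diagonal matrix Λ, let f : ℝ → ℝ be continuous, and let Y be any real d×s matrix. With Z := (I − Q Qᵀ) Y, it holds that Yᵀ f(H) Y − Yᵀ Q f(Λ) Qᵀ Y = Zᵀ f(H) Z. -/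
open Matrix

/-- A weighted sum of rank-one matrices `u i (u i)ᵀ` is `Uᵀ diag(c) U`, where `U` has rows `u i`. -/
theorem sum_smul_vecMulVec_self {m n R : Type*} [Fintype m] [DecidableEq m] [CommSemiring R]
    (u : m → n → R) (c : m → R) :
    ∑ i, c i • vecMulVec (u i) (u i) = (of u)ᵀ * diagonal c * of u := by
  ext x y
  simp only [Matrix.sum_apply, Matrix.smul_apply, vecMulVec_apply, smul_eq_mul,
    Matrix.mul_apply (M := (of u)ᵀ * diagonal c), mul_diagonal, transpose_apply, of_apply]
  exact Finset.sum_congr rfl fun i _ => by ring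

/-- A matrix intertwining two diagonal matrices intertwines their images under any function. -/
theorem diagonal_comp_mul_eq_mul_diagonal_comp {m n R : Type*} [Fintype m] [DecidableEq m]
    [Fintype n] [DecidableEq n] [CommRing R] [IsDomain R] {a : m → R} {b : n → R}
    {W : Matrix m n R} (h : diagonal a * W = W * diagonal b) (f : R → R) :
    diagonal (fun i => f (a i)) * W = W * diagonal (fun j => f (b j)) := by
  ext i j
  have hij := congrFun (congrFun h i) j
  rw [diagonal_mul, mul_diagonal, mul_comm] at hij ⊢
  by_cases hW : W i j = 0
  · simp [hW]
  · rw [mul_left_cancel₀ hW hij]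

/-- Deflating a symmetric matrix by an orthonormal basis `Q` of an invariant subspace. -/
theorem one_sub_mul_transpose_mul_mul_one_sub {m n R : Type*} [Fintype m] [DecidableEq m]
    [Fintype n] [DecidableEq n] [CommRing R] {F : Matrix m m R} (hF : Fᵀ = F)
    {Q : Matrix m n R} (hQ : Qᵀ * Q = 1) {D : Matrix n n R} (hD : Dᵀ = D)
    (hFQ : F * Q = Q * D) :
    (1 - Q * Qᵀ) * F * (1 - Q * Qᵀ) = F - Q * D * Qᵀ := by
  have hQF : Qᵀ * F = D * Qᵀ := by
    simpa [transpose_mul, hF, hD] using congrArg transpose hFQ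
  have hFP : F * (1 - Q * Qᵀ) = F - Q * D * Qᵀ := by
    rw [mul_sub, mul_one, ← Matrix.mul_assoc, hFQ]
  have hP : Qᵀ * (F - Q * D * Qᵀ) = 0 := by
    rw [Matrix.mul_sub, hQF, Matrix.mul_assoc Q, ← Matrix.mul_assoc Qᵀ, hQ, Matrix.one_mul,
      sub_self]
  rw [Matrix.mul_assoc, hFP, sub_mul, one_mul, Matrix.mul_assoc Q Qᵀ, hP, Matrix.mul_zero, sub_zero]

/-- For a real symmetric `H` with orthonormal eigendecomposition `H = Σ μ_i u_i u_iᵀ`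
(so that `f(H) = Σ f(μ_i) u_i u_iᵀ`), `Q` with orthonormal eigenvector columns
(`H Q = Q Λ`, `Λ` diagonal), continuous `f` and any `Y`, setting `Z := (I − Q Qᵀ) Y` we
have `Yᵀ f(H) Y − Yᵀ Q f(Λ) Qᵀ Y = Zᵀ f(H) Z`. -/
theorem deflated_quadratic_form_eq
    {d k s : ℕ} (H : Matrix (Fin d) (Fin d) ℝ) (hH : Hᵀ = H)
    (u : Fin d → Fin d → ℝ) (mu : Fin d → ℝ)
    (horth : ∀ i j : Fin d, ∑ x, u i x * u j x = if i = j then 1 else 0)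
    (hdecomp : H = ∑ i, mu i • Matrix.vecMulVec (u i) (u i))
    (Q : Matrix (Fin d) (Fin k) ℝ) (hQ : Qᵀ * Q = 1)
    (lam : Fin k → ℝ) (hHQ : H * Q = Q * Matrix.diagonal lam)
    (f : ℝ → ℝ) (hf : Continuous f)
    (Y : Matrix (Fin d) (Fin s) ℝ) :
    Yᵀ * (∑ i, f (mu i) • Matrix.vecMulVec (u i) (u i)) * Y
        - Yᵀ * Q * Matrix.diagonal (fun a => f (lam a)) * Qᵀ * Y
      = ((1 - Q * Qᵀ) * Y)ᵀ * (∑ i, f (mu i) • Matrix.vecMulVec (u i) (u i))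
          * ((1 - Q * Qᵀ) * Y) := by
  set U : Matrix (Fin d) (Fin d) ℝ := of u
  rw [sum_smul_vecMulVec_self] at hdecomp ⊢
  have hUUt : U * Uᵀ = 1 := by
    ext i j
    simpa [U, Matrix.mul_apply, Matrix.one_apply] using horth i j
  have hUtU : Uᵀ * U = 1 := mul_eq_one_comm.mp hUUt
  have hdiag : diagonal mu * (U * Q) = U * Q * diagonal lam := by
    calc diagonal mu * (U * Q) = U * Uᵀ * (diagonal mu * (U * Q)) := by
          rw [hUUt, Matrix.one_mul]
      _ = U * (Uᵀ * diagonal mu * U * Q) := by simp only [Matrix.mul_assoc]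
      _ = U * Q * diagonal lam := by rw [← hdecomp, hHQ, Matrix.mul_assoc]
  set F := Uᵀ * diagonal (fun i => f (mu i)) * U with hFdef
  have hF : Fᵀ = F := by simp [F, transpose_mul, Matrix.mul_assoc]
  have hFQ : F * Q = Q * diagonal (fun a => f (lam a)) := by
    rw [hFdef, Matrix.mul_assoc, Matrix.mul_assoc,
      diagonal_comp_mul_eq_mul_diagonal_comp hdiag f, ← Matrix.mul_assoc, ← Matrix.mul_assoc,
      hUtU, Matrix.one_mul]
  have hdefl := one_sub_mul_transpose_mul_mul_one_sub hF hQ (diagonal_transpose _) hFQ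
  have hP : (1 - Q * Qᵀ)ᵀ = 1 - Q * Qᵀ := by simp [transpose_mul]
  calc _ = Yᵀ * (F - Q * diagonal (fun a => f (lam a)) * Qᵀ) * Y := by
        simp only [Matrix.mul_sub, Matrix.sub_mul, Matrix.mul_assoc]
    _ = _ := by
        rw [← hdefl, transpose_mul, hP]
        simp only [Matrix.mul_assoc]
end

section
/- Let A be a real matrix indexed by (S × B) × (S × B) with B × B blocks A_{i,j} = (A_{(i,k),(j,l)})_{k,l} for i, j ∈ S, and let v : Ω → ℝ^B be a random vector with independent standard real Gaussian coordinates. Then the variance of the matrix-valued estimator (I_S ⊗ v)ᵀ A (I_S ⊗ v) satisfies V[(I_S ⊗ v)ᵀ A (I_S ⊗ v)] = Σ_{i ∈ S} Σ_{j ∈ S} V[vᵀ A_{i,j} v] ≤ Σ_{i ∈ S} Σ_{j ∈ S} 2 ‖A_{i,j}‖_F² = 2 ‖A‖_F². -/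
open MeasureTheory ProbabilityTheory Matrix

lemma integrable_pow_gaussianReal (n : ℕ) :
    Integrable (fun x : ℝ => x ^ n) (gaussianReal 0 1) := by
  have h := (memLp_id_gaussianReal' (μ := 0) (v := 1) (n : ENNReal) (by simp)).integrable_norm_pow'
  exact (integrable_norm_iff (by fun_prop)).1 (by simpa using h)

/-- Differentiating `p(t) exp(t² / 2)` replaces `p` by `p' + t p`. -/
lemma deriv_mul_exp_sq_half {p p' : ℝ → ℝ} (hp : ∀ t, HasDerivAt p (p' t) t) :
    deriv (fun t => p t * Real.exp (t ^ 2 / 2)) =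
      fun t => (p' t + t * p t) * Real.exp (t ^ 2 / 2) := by
  funext t
  have hexp : HasDerivAt (fun t : ℝ => Real.exp (t ^ 2 / 2)) (Real.exp (t ^ 2 / 2) * t) t := by
    have h := ((hasDerivAt_pow 2 t).div_const 2).exp
    convert h using 2
    norm_num
  rw [((hp t).fun_mul hexp).deriv]
  ring

lemma integral_pow_gaussianReal (n : ℕ) :
    ∫ x, x ^ n ∂(gaussianReal 0 1) =
      iteratedDeriv n (fun t : ℝ => 1 * Real.exp (t ^ 2 / 2)) 0 := by
  have h := iteratedDeriv_mgf_zero (X := id) (μ := gaussianReal 0 1) (by simp) n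
  rw [mgf_id_gaussianReal] at h
  simpa using h.symm

lemma iteratedDeriv_exp_sq_half :
    iteratedDeriv 1 (fun t : ℝ => 1 * Real.exp (t ^ 2 / 2)) =
      (fun t => t * Real.exp (t ^ 2 / 2)) ∧
    iteratedDeriv 2 (fun t : ℝ => 1 * Real.exp (t ^ 2 / 2)) =
      (fun t => (1 + t ^ 2) * Real.exp (t ^ 2 / 2)) ∧
    iteratedDeriv 3 (fun t : ℝ => 1 * Real.exp (t ^ 2 / 2)) =
      (fun t => (3 * t + t ^ 3) * Real.exp (t ^ 2 / 2)) ∧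
    iteratedDeriv 4 (fun t : ℝ => 1 * Real.exp (t ^ 2 / 2)) =
      (fun t => (3 + 6 * t ^ 2 + t ^ 4) * Real.exp (t ^ 2 / 2)) := by
  have h1 : iteratedDeriv 1 (fun t : ℝ => 1 * Real.exp (t ^ 2 / 2)) =
      (fun t => t * Real.exp (t ^ 2 / 2)) := by
    rw [iteratedDeriv_one, deriv_mul_exp_sq_half (fun t => hasDerivAt_const t 1)]
    simp
  have h2 : iteratedDeriv 2 (fun t : ℝ => 1 * Real.exp (t ^ 2 / 2)) =
      (fun t => (1 + t ^ 2) * Real.exp (t ^ 2 / 2)) := by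
    rw [iteratedDeriv_succ, h1, deriv_mul_exp_sq_half hasDerivAt_id']
    funext t; ring
  have h3 : iteratedDeriv 3 (fun t : ℝ => 1 * Real.exp (t ^ 2 / 2)) =
      (fun t => (3 * t + t ^ 3) * Real.exp (t ^ 2 / 2)) := by
    rw [iteratedDeriv_succ, h2,
      deriv_mul_exp_sq_half (fun t => (hasDerivAt_pow 2 t).const_add 1)]
    funext t; norm_num; ring
  refine ⟨h1, h2, h3, ?_⟩
  rw [iteratedDeriv_succ, h3, deriv_mul_exp_sq_half
    (fun t => ((hasDerivAt_id' t).const_mul 3).fun_add (hasDerivAt_pow 3 t))]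
  funext t; norm_num; ring

lemma integral_pow_one_gaussianReal : ∫ x, x ^ 1 ∂(gaussianReal 0 1) = (0 : ℝ) := by
  rw [integral_pow_gaussianReal, iteratedDeriv_exp_sq_half.1]; simp

lemma integral_pow_two_gaussianReal : ∫ x, x ^ 2 ∂(gaussianReal 0 1) = (1 : ℝ) := by
  rw [integral_pow_gaussianReal, iteratedDeriv_exp_sq_half.2.1]; simp

lemma integral_pow_three_gaussianReal : ∫ x, x ^ 3 ∂(gaussianReal 0 1) = (0 : ℝ) := by
  rw [integral_pow_gaussianReal, iteratedDeriv_exp_sq_half.2.2.1]; simp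

lemma integral_pow_four_gaussianReal : ∫ x, x ^ 4 ∂(gaussianReal 0 1) = (3 : ℝ) := by
  rw [integral_pow_gaussianReal, iteratedDeriv_exp_sq_half.2.2.2]; simp

section StandardGaussianVector

variable {B : Type*} [Fintype B]

lemma integrable_prod_pow_pi_gaussianReal (c : B → ℕ) :
    Integrable (fun x : B → ℝ => ∏ i, x i ^ c i) (Measure.pi fun _ => gaussianReal 0 1) :=
  Integrable.fintype_prod (f := fun i (y : ℝ) => y ^ c i)
    (fun i => integrable_pow_gaussianReal (c i))

lemma integral_prod_pow_pi_gaussianReal (c : B → ℕ) :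
    ∫ x : B → ℝ, ∏ i, x i ^ c i ∂(Measure.pi fun _ => gaussianReal 0 1) =
      ∏ i, ∫ y : ℝ, y ^ c i ∂(gaussianReal 0 1) :=
  integral_fintype_prod_eq_prod (𝕜 := ℝ) (fun i (y : ℝ) => y ^ c i)

variable [DecidableEq B]

lemma mul_eq_prod_pow (x : B → ℝ) (k l : B) :
    x k * x l = ∏ i, x i ^ ((if i = k then 1 else 0) + (if i = l then 1 else 0)) := by
  simp only [pow_add, Finset.prod_mul_distrib]
  simp [pow_ite]

lemma mul_mul_eq_prod_pow (x : B → ℝ) (k l m n : B) :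
    (x k * x l) * (x m * x n) = ∏ i, x i ^ ((if i = k then 1 else 0) + (if i = l then 1 else 0)
      + (if i = m then 1 else 0) + (if i = n then 1 else 0)) := by
  simp only [pow_add, Finset.prod_mul_distrib]
  simp [pow_ite, mul_assoc]

lemma integral_mul_pi_gaussianReal (k l : B) :
    ∫ x : B → ℝ, x k * x l ∂(Measure.pi fun _ => gaussianReal 0 1) = if k = l then 1 else 0 := by
  simp_rw [mul_eq_prod_pow, integral_prod_pow_pi_gaussianReal]
  by_cases h : k = l
  · subst h
    rw [if_pos rfl]
    refine Finset.prod_eq_one fun i _ => ?_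
    by_cases hi : i = k
    · simpa [hi] using integral_pow_two_gaussianReal
    · simp [hi]
  · rw [if_neg h]
    refine Finset.prod_eq_zero (Finset.mem_univ k) ?_
    simp [h]

lemma integral_mul_mul_pi_gaussianReal_of_ne {k l m n : B} (hl : k ≠ l) (hm : k ≠ m)
    (hn : k ≠ n) :
    ∫ x : B → ℝ, (x k * x l) * (x m * x n) ∂(Measure.pi fun _ => gaussianReal 0 1) = 0 := by
  simp_rw [mul_mul_eq_prod_pow, integral_prod_pow_pi_gaussianReal]
  refine Finset.prod_eq_zero (Finset.mem_univ k) ?_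
  simp [hl, hm, hn]

lemma integral_sq_mul_mul_pi_gaussianReal (k m n : B) :
    ∫ x : B → ℝ, (x k * x k) * (x m * x n) ∂(Measure.pi fun _ => gaussianReal 0 1) =
      (if m = n then 1 else 0) + 2 * ((if k = m then 1 else 0) * (if k = n then 1 else 0)) := by
  by_cases hmn : m = n
  · subst hmn
    simp_rw [mul_mul_eq_prod_pow, integral_prod_pow_pi_gaussianReal]
    by_cases hkm : k = m
    · subst hkm
      rw [Finset.prod_eq_single k (fun i _ hi => by simp [hi]) (by simp)]
      norm_num [integral_pow_four_gaussianReal]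
    · rw [Finset.prod_eq_one fun i _ => ?_]
      · simp [hkm]
      · by_cases hik : i = k
        · simpa [hik, hkm] using integral_pow_two_gaussianReal
        · by_cases him : i = m
          · simpa [him, Ne.symm hkm] using integral_pow_two_gaussianReal
          · simp [hik, him]
  · by_cases hkm : k = m
    · subst hkm
      have h := integral_mul_mul_pi_gaussianReal_of_ne (Ne.symm hmn) (Ne.symm hmn) (Ne.symm hmn)
      simp only [hmn, if_false, mul_zero, add_zero]
      exact (integral_congr_ae (ae_of_all _ fun x => by ring)).trans h
    · have h := integral_mul_mul_pi_gaussianReal_of_ne hmn (Ne.symm hkm) (Ne.symm hkm)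
      simp only [hmn, hkm, if_false, mul_zero, zero_mul, add_zero]
      exact (integral_congr_ae (ae_of_all _ fun x => by ring)).trans h

/-- Isserlis' formula for fourth-order moments of a standard Gaussian vector. -/
lemma integral_mul_mul_pi_gaussianReal (k l m n : B) :
    ∫ x : B → ℝ, (x k * x l) * (x m * x n) ∂(Measure.pi fun _ => gaussianReal 0 1) =
      (if k = l then 1 else 0) * (if m = n then 1 else 0)
        + (if k = m then 1 else 0) * (if l = n then 1 else 0)
        + (if k = n then 1 else 0) * (if l = m then 1 else 0) := by
  by_cases hl : k = l
  · subst hl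
    rw [integral_sq_mul_mul_pi_gaussianReal, if_pos rfl]
    ring
  by_cases hm : k = m
  · subst hm
    trans ∫ x : B → ℝ, (x k * x k) * (x l * x n) ∂(Measure.pi fun _ => gaussianReal 0 1)
    · exact integral_congr_ae (ae_of_all _ fun x => by ring)
    · simp [integral_sq_mul_mul_pi_gaussianReal, hl, Ne.symm hl]
  by_cases hn : k = n
  · subst hn
    trans ∫ x : B → ℝ, (x k * x k) * (x l * x m) ∂(Measure.pi fun _ => gaussianReal 0 1)
    · exact integral_congr_ae (ae_of_all _ fun x => by ring)
    · simp [integral_sq_mul_mul_pi_gaussianReal, hl, hm]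
  simp [integral_mul_mul_pi_gaussianReal_of_ne hl hm hn, hl, hm, hn]

lemma integrable_mul_pi_gaussianReal (k l : B) :
    Integrable (fun x : B → ℝ => x k * x l) (Measure.pi fun _ => gaussianReal 0 1) := by
  simp_rw [mul_eq_prod_pow]
  exact integrable_prod_pow_pi_gaussianReal _

lemma integrable_mul_mul_pi_gaussianReal (k l m n : B) :
    Integrable (fun x : B → ℝ => (x k * x l) * (x m * x n))
      (Measure.pi fun _ => gaussianReal 0 1) := by
  simp_rw [mul_mul_eq_prod_pow]
  exact integrable_prod_pow_pi_gaussianReal _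

end StandardGaussianVector

section QuadraticForm

variable {B : Type*} [Fintype B] (a : B → B → ℝ)

lemma sq_quadratic_form_eq_sum (x : B → ℝ) :
    (∑ k, ∑ l, x k * a k l * x l) ^ 2 =
      ∑ k, ∑ l, ∑ m, ∑ n, a k l * a m n * ((x k * x l) * (x m * x n)) := by
  rw [sq, Finset.sum_mul]
  refine Finset.sum_congr rfl fun k _ => ?_
  rw [Finset.sum_mul]
  refine Finset.sum_congr rfl fun l _ => ?_
  rw [Finset.mul_sum]
  refine Finset.sum_congr rfl fun m _ => ?_
  rw [Finset.mul_sum]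
  exact Finset.sum_congr rfl fun n _ => by ring

lemma integrable_quadratic_form :
    Integrable (fun x : B → ℝ => ∑ k, ∑ l, x k * a k l * x l)
      (Measure.pi fun _ => gaussianReal 0 1) := by
  classical
  refine integrable_finsetSum _ fun k _ => integrable_finsetSum _ fun l _ => ?_
  refine ((integrable_mul_pi_gaussianReal k l).const_mul (a k l)).congr (ae_of_all _ fun x => ?_)
  ring

lemma integrable_sq_quadratic_form :
    Integrable (fun x : B → ℝ => (∑ k, ∑ l, x k * a k l * x l) ^ 2)
      (Measure.pi fun _ => gaussianReal 0 1) := by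
  classical
  simp_rw [sq_quadratic_form_eq_sum]
  exact integrable_finsetSum _ fun k _ => integrable_finsetSum _ fun l _ =>
    integrable_finsetSum _ fun m _ => integrable_finsetSum _ fun n _ =>
      (integrable_mul_mul_pi_gaussianReal k l m n).const_mul _

lemma integrable_sq_quadratic_form_sub_const (c : ℝ) :
    Integrable (fun x : B → ℝ => ((∑ k, ∑ l, x k * a k l * x l) - c) ^ 2)
      (Measure.pi fun _ => gaussianReal 0 1) := by
  simp_rw [sub_sq]
  exact ((integrable_sq_quadratic_form a).sub
    (((integrable_quadratic_form a).const_mul 2).mul_const c)).add (integrable_const _)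

lemma integral_quadratic_form :
    ∫ x : B → ℝ, ∑ k, ∑ l, x k * a k l * x l ∂(Measure.pi fun _ => gaussianReal 0 1) =
      ∑ k, a k k := by
  classical
  have h : ∀ (x : B → ℝ) (k l : B), x k * a k l * x l = a k l * (x k * x l) :=
    fun x k l => by ring
  simp_rw [h]
  have hInt : ∀ k l : B, Integrable (fun x : B → ℝ => a k l * (x k * x l))
      (Measure.pi fun _ => gaussianReal 0 1) :=
    fun k l => (integrable_mul_pi_gaussianReal k l).const_mul _
  rw [integral_finsetSum _ fun k _ => integrable_finsetSum _ fun l _ => hInt k l]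
  refine Finset.sum_congr rfl fun k _ => ?_
  rw [integral_finsetSum _ fun l _ => hInt k l]
  simp [integral_const_mul, integral_mul_pi_gaussianReal]

lemma integral_sq_quadratic_form :
    ∫ x : B → ℝ, (∑ k, ∑ l, x k * a k l * x l) ^ 2 ∂(Measure.pi fun _ => gaussianReal 0 1) =
      (∑ k, a k k) ^ 2 + ∑ k, ∑ l, a k l ^ 2 + ∑ k, ∑ l, a k l * a l k := by
  classical
  simp_rw [sq_quadratic_form_eq_sum]
  have hInt : ∀ k l m n : B, Integrable
      (fun x : B → ℝ => a k l * a m n * ((x k * x l) * (x m * x n)))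
      (Measure.pi fun _ => gaussianReal 0 1) :=
    fun k l m n => (integrable_mul_mul_pi_gaussianReal k l m n).const_mul _
  have hsum : ∫ x : B → ℝ, ∑ k, ∑ l, ∑ m, ∑ n, a k l * a m n * ((x k * x l) * (x m * x n))
        ∂(Measure.pi fun _ => gaussianReal 0 1) =
      ∑ k, ∑ l, ∑ m, ∑ n, a k l * a m n *
        ((if k = l then 1 else 0) * (if m = n then 1 else 0)
        + (if k = m then 1 else 0) * (if l = n then 1 else 0)
        + (if k = n then 1 else 0) * (if l = m then 1 else 0)) := by
    rw [integral_finsetSum _ fun k _ => integrable_finsetSum _ fun l _ =>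
      integrable_finsetSum _ fun m _ => integrable_finsetSum _ fun n _ => hInt k l m n]
    refine Finset.sum_congr rfl fun k _ => ?_
    rw [integral_finsetSum _ fun l _ => integrable_finsetSum _ fun m _ =>
      integrable_finsetSum _ fun n _ => hInt k l m n]
    refine Finset.sum_congr rfl fun l _ => ?_
    rw [integral_finsetSum _ fun m _ => integrable_finsetSum _ fun n _ => hInt k l m n]
    refine Finset.sum_congr rfl fun m _ => ?_
    rw [integral_finsetSum _ fun n _ => hInt k l m n]
    refine Finset.sum_congr rfl fun n _ => ?_
    rw [integral_const_mul, integral_mul_mul_pi_gaussianReal]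
  rw [hsum]
  simp only [mul_add, Finset.sum_add_distrib]
  congr 1
  · congr 1
    · simp [sq, Finset.sum_mul_sum]
    · simp [sq]
  · simp

/-- The variance of a quadratic form in a standard Gaussian vector. -/
lemma integral_sq_quadratic_form_sub_trace :
    ∫ x : B → ℝ, ((∑ k, ∑ l, x k * a k l * x l) - ∑ k, a k k) ^ 2
        ∂(Measure.pi fun _ => gaussianReal 0 1) =
      ∑ k, ∑ l, a k l ^ 2 + ∑ k, ∑ l, a k l * a l k := by
  have hq := integrable_quadratic_form a
  have hq2 := integrable_sq_quadratic_form a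
  have hsub : Integrable (fun x : B → ℝ => (∑ k, ∑ l, x k * a k l * x l) ^ 2
      - 2 * (∑ k, ∑ l, x k * a k l * x l) * ∑ k, a k k) (Measure.pi fun _ => gaussianReal 0 1) :=
    hq2.sub ((hq.const_mul 2).mul_const _)
  simp_rw [sub_sq]
  rw [integral_add hsub (integrable_const _),
    integral_sub hq2 ((hq.const_mul 2).mul_const _), integral_mul_const, integral_const_mul,
    integral_quadratic_form, integral_sq_quadratic_form]
  simp
  ring

lemma sum_mul_transpose_le_sum_sq :
    ∑ k, ∑ l, a k l * a l k ≤ ∑ k, ∑ l, a k l ^ 2 := by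
  have hcomm : ∑ k, ∑ l, a l k ^ 2 = ∑ k, ∑ l, a k l ^ 2 := Finset.sum_comm
  have h : ∑ k, ∑ l, 2 * (a k l * a l k) ≤ ∑ k, ∑ l, (a k l ^ 2 + a l k ^ 2) :=
    Finset.sum_le_sum fun k _ => Finset.sum_le_sum fun l _ => by
      nlinarith [sq_nonneg (a k l - a l k)]
  simp only [Finset.sum_add_distrib, ← Finset.mul_sum] at h
  linarith

end QuadraticForm

/-- For a standard Gaussian vector `v` the variance of the matrix-valued estimator
`(I_S ⊗ v)ᵀ A (I_S ⊗ v)` equals the sum of the variances of its entries `vᵀ A_{i,j} v`,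
which is at most `Σ_{i,j} 2 ‖A_{i,j}‖_F² = 2 ‖A‖_F²`. -/
theorem variance_partial_trace_estimator
    {S B : Type*} [Fintype S] [Fintype B]
    (A : Matrix (S × B) (S × B) ℝ)
    {Ω : Type*} [MeasurableSpace Ω] (μ : Measure Ω) [IsProbabilityMeasure μ]
    (v : Ω → B → ℝ) (hv : Measurable v)
    (hdist : Measure.map v μ = Measure.pi (fun _ : B => gaussianReal 0 1)) :
    (∫ ω, ∑ i : S, ∑ j : S,
        ((∑ k, ∑ l, v ω k * A (i, k) (j, l) * v ω l)
          - ∫ ω', ∑ k, ∑ l, v ω' k * A (i, k) (j, l) * v ω' l ∂μ) ^ 2 ∂μ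
      = ∑ i : S, ∑ j : S, ∫ ω,
          ((∑ k, ∑ l, v ω k * A (i, k) (j, l) * v ω l)
            - ∫ ω', ∑ k, ∑ l, v ω' k * A (i, k) (j, l) * v ω' l ∂μ) ^ 2 ∂μ)
    ∧ (∑ i : S, ∑ j : S, ∫ ω,
          ((∑ k, ∑ l, v ω k * A (i, k) (j, l) * v ω l)
            - ∫ ω', ∑ k, ∑ l, v ω' k * A (i, k) (j, l) * v ω' l ∂μ) ^ 2 ∂μ
        ≤ ∑ i : S, ∑ j : S, 2 * ∑ k : B, ∑ l : B, (A (i, k) (j, l)) ^ 2)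
    ∧ (∑ i : S, ∑ j : S, 2 * ∑ k : B, ∑ l : B, (A (i, k) (j, l)) ^ 2
        = 2 * ∑ i : S, ∑ j : S, ∑ k : B, ∑ l : B, (A (i, k) (j, l)) ^ 2) := by
  have hmean : ∀ i j, ∫ ω, ∑ k, ∑ l, v ω k * A (i, k) (j, l) * v ω l ∂μ = ∑ k, A (i, k) (j, k) := by
    intro i j
    have h := integral_quadratic_form fun k l => A (i, k) (j, l)
    rwa [← hdist, integral_map hv.aemeasurable (by fun_prop)] at h
  have hInt : ∀ i j, Integrable (fun ω => ((∑ k, ∑ l, v ω k * A (i, k) (j, l) * v ω l)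
      - ∑ k, A (i, k) (j, k)) ^ 2) μ := by
    intro i j
    have h := integrable_sq_quadratic_form_sub_const (fun k l => A (i, k) (j, l))
      (∑ k, A (i, k) (j, k))
    rw [← hdist] at h
    exact h.comp_measurable hv
  simp_rw [hmean]
  refine ⟨?_, ?_, by simp only [Finset.mul_sum]⟩
  · rw [integral_finsetSum _ fun i _ => integrable_finsetSum _ fun j _ => hInt i j]
    exact Finset.sum_congr rfl fun i _ => integral_finsetSum _ fun j _ => hInt i j
  · refine Finset.sum_le_sum fun i _ => Finset.sum_le_sum fun j _ => ?_
    have h := integral_sq_quadratic_form_sub_trace fun k l => A (i, k) (j, l)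
    rw [← hdist, integral_map hv.aemeasurable (by fun_prop)] at h
    rw [h]
    linarith [sum_mul_transpose_le_sum_sq fun k l => A (i, k) (j, l)]
end
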